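/- Let L be a real normal N×N matrix with a simple eigenvalue 0 and all other eigenvalues having positive real part, and let a_0, a_1, a_2 > 0. If the eigenvalue λ_2 of L with smallest positive real part satisfies a_2 (Re λ_2)² (a_2 a_1 Re λ_2 − a_0) + a_1 (Im λ_2)² (a_2² Re λ_2 − a_1) < 0, then the 3N×3N closed-loop matrix A = [[0, I, 0],[0, 0, I],[−a_0 L, −a_1 L, −a_2 L]] has an eigenvalue with positive real part (besides its three zero eigenvalues), so third-order consensus fails. -/

import Mathlib

open Matrix

/-- The closed-loop matrix of `n`-th order consensus: block companion matrix
with identity blocks on the block superdiagonal and bottom block row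
`(-a₀ L, -a₁ L, …, -a_{n-1} L)`. -/
def blockCompanion {R : Type*} [CommRing R] (n N : ℕ) (a : Fin n → R)
    (L : Matrix (Fin N) (Fin N) R) :
    Matrix (Fin n × Fin N) (Fin n × Fin N) R :=
  fun p q =>
    if p.1.val + 1 = q.1.val then (if p.2 = q.2 then 1 else 0)
    else if p.1.val = n - 1 then -(a q.1) * L p.2 q.2
    else 0

/-- If a monic complex cubic has all its roots in the closed left half-plane, then its second
Hurwitz determinant is nonnegative. -/
theorem hurwitz_det_two_nonneg_of_roots_re_nonpos {b c d x y z : ℂ}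
    (hb : b = -(x + y + z)) (hc : c = x * y + x * z + y * z) (hd : d = -(x * y * z))
    (hx : x.re ≤ 0) (hy : y.re ≤ 0) (hz : z.re ≤ 0) :
    0 ≤ b.re ^ 2 * c.re + b.re * b.im * c.im - b.re * d.re - c.im ^ 2 := by
  have hxy : 0 ≤ x.re * y.re := mul_nonneg_of_nonpos_of_nonpos hx hy
  have hyz : 0 ≤ y.re * z.re := mul_nonneg_of_nonpos_of_nonpos hy hz
  have hxz : 0 ≤ x.re * z.re := mul_nonneg_of_nonpos_of_nonpos hx hz
  have key : b.re ^ 2 * c.re + b.re * b.im * c.im - b.re * d.re - c.im ^ 2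
      = x.re * y.re * ((x.re + y.re) ^ 2 + (x.im - y.im) ^ 2)
        + y.re * z.re * ((y.re + z.re) ^ 2 + (y.im - z.im) ^ 2)
        + x.re * z.re * ((x.re + 2 * y.re + z.re) ^ 2 + (x.im - z.im) ^ 2) := by
    simp only [hb, hc, hd, Complex.add_re, Complex.add_im, Complex.neg_re, Complex.neg_im,
      Complex.mul_re, Complex.mul_im]
    ring
  rw [key]
  positivity

/-- A monic complex cubic with negative second Hurwitz determinant has a root in the open right
half-plane. -/
theorem exists_cubic_root_re_pos_of_hurwitz_det_two_neg (b c d : ℂ)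
    (h : b.re ^ 2 * c.re + b.re * b.im * c.im - b.re * d.re - c.im ^ 2 < 0) :
    ∃ s : ℂ, s ^ 3 + b * s ^ 2 + c * s + d = 0 ∧ 0 < s.re := by
  let P : Cubic ℂ := ⟨1, b, c, d⟩
  have ha : P.a ≠ 0 := one_ne_zero
  obtain ⟨x, y, z, h3⟩ := (Cubic.splits_iff_roots_eq_three (φ := RingHom.id ℂ) ha).1
    (IsAlgClosed.splits _)
  have hb : b = -(x + y + z) := by simpa [P] using Cubic.b_eq_three_roots ha h3
  have hc : c = x * y + x * z + y * z := by simpa [P] using Cubic.c_eq_three_roots ha h3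
  have hd : d = -(x * y * z) := by simpa [P] using Cubic.d_eq_three_roots ha h3
  by_contra! hs
  refine h.not_ge (hurwitz_det_two_nonneg_of_roots_re_nonpos hb hc hd
    (hs x ?_) (hs y ?_) (hs z ?_)) <;> rw [hb, hc, hd] <;> ring

/-- An element is in the spectrum of a matrix over a field exactly when it has an eigenvector. -/
theorem Matrix.mem_spectrum_iff_exists_mulVec_eq_smul {n K : Type*} [Fintype n] [DecidableEq n]
    [Field K] {A : Matrix n n K} {μ : K} :
    μ ∈ spectrum K A ↔ ∃ v, v ≠ 0 ∧ A *ᵥ v = μ • v := by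
  rw [← Matrix.spectrum_toLin', ← Module.End.hasEigenvalue_iff_mem_spectrum]
  constructor
  · intro h
    obtain ⟨v, hv⟩ := h.exists_hasEigenvector
    exact ⟨v, hv.2, by simpa using hv.apply_eq_smul⟩
  · rintro ⟨v, hv, h⟩
    exact Module.End.hasEigenvalue_of_hasEigenvector
      ⟨Module.End.mem_eigenspace_iff.2 (by simpa using h), hv⟩

/-- The roots of `s³ + a₂ lam s² + a₁ lam s + a₀ lam`, for `lam` an eigenvalue of `L`, are
eigenvalues of the third-order closed-loop matrix. -/
theorem mem_spectrum_blockCompanion_three {N : ℕ} {L : Matrix (Fin N) (Fin N) ℝ} {lam s : ℂ}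
    (hlam : lam ∈ spectrum ℂ (L.map (fun r => (r : ℂ)))) (a0 a1 a2 : ℝ)
    (hs : s ^ 3 + a2 * lam * s ^ 2 + a1 * lam * s + a0 * lam = 0) :
    s ∈ spectrum ℂ ((blockCompanion 3 N ![a0, a1, a2] L).map (fun r => (r : ℂ))) := by
  obtain ⟨w, hw, hLw⟩ := Matrix.mem_spectrum_iff_exists_mulVec_eq_smul.1 hlam
  refine Matrix.mem_spectrum_iff_exists_mulVec_eq_smul.2
    ⟨fun p => s ^ (p.1 : ℕ) * w p.2, fun h => hw ?_, ?_⟩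
  · ext i
    simpa using congrFun h (0, i)
  · ext ⟨k, i⟩
    have hi : ∑ j, (L i j : ℂ) * w j = lam * w i := by
      simpa [Matrix.mulVec, dotProduct] using congrFun hLw i
    have hscale (c d : ℂ) : ∑ j, c * L i j * (d * w j) = c * d * (lam * w i) := by
      rw [← hi, Finset.mul_sum]
      exact Finset.sum_congr rfl fun j _ => by ring
    have hscale_one (c : ℂ) : ∑ j, c * L i j * w j = c * (lam * w i) := by
      simpa using hscale c 1
    fin_cases k
    · simp [Matrix.mulVec, dotProduct, Fintype.sum_prod_type, Fin.sum_univ_three, blockCompanion,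
        apply_ite Complex.ofReal]
    · simp [Matrix.mulVec, dotProduct, Fintype.sum_prod_type, Fin.sum_univ_three, blockCompanion,
        apply_ite Complex.ofReal]
      ring
    · simp [Matrix.mulVec, dotProduct, Fintype.sum_prod_type, Fin.sum_univ_three, blockCompanion,
        hscale, hscale_one]
      linear_combination (-w i) * hs

/-- For third-order consensus over a normal Laplacian with simple zero
eigenvalue, strict violation of the complex Routh–Hurwitz condition at the
eigenvalue `λ₂` of smallest positive real part forces an eigenvalue of the
closed-loop matrix into the open right half-plane. -/
theorem third_order_consensus_fails_of_routh_hurwitz (N : ℕ)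
    (L : Matrix (Fin N) (Fin N) ℝ) (hnormal : Lᵀ * L = L * Lᵀ)
    (hsimple : (L.charpoly).rootMultiplicity 0 = 1)
    (lam2 : ℂ) (hmem : lam2 ∈ spectrum ℂ (L.map (fun r => (r : ℂ))))
    (hre : 0 < lam2.re)
    (hall : ∀ μ ∈ spectrum ℂ (L.map (fun r => (r : ℂ))), μ = 0 ∨ 0 < μ.re)
    (hmin : ∀ μ ∈ spectrum ℂ (L.map (fun r => (r : ℂ))), μ ≠ 0 → lam2.re ≤ μ.re)
    (a0 a1 a2 : ℝ) (ha0 : 0 < a0) (ha1 : 0 < a1) (ha2 : 0 < a2)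
    (hRH : a2 * lam2.re ^ 2 * (a2 * a1 * lam2.re - a0)
        + a1 * lam2.im ^ 2 * (a2 ^ 2 * lam2.re - a1) < 0) :
    ∃ μ ∈ spectrum ℂ
      ((blockCompanion 3 N ![a0, a1, a2] L).map (fun r => (r : ℂ))),
      0 < μ.re := by
  obtain ⟨s, hs, hpos⟩ := exists_cubic_root_re_pos_of_hurwitz_det_two_neg
    (a2 * lam2) (a1 * lam2) (a0 * lam2) (by
      simp only [Complex.re_ofReal_mul, Complex.im_ofReal_mul]
      linarith)
  exact ⟨s, mem_spectrum_blockCompanion_three hmem a0 a1 a2 hs, hpos⟩
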